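/- Let A = {1,…,k} with k ≥ 3, and let S be the set of gates 1-SWAP_{a,b} for all a ≠ b ∈ A. Then S generates the controlled swap w-SWAP_{a,b} for every string w over A and all a, b ∈ A. -/

import Mathlib

/-- A reversible gate function of arity `n` over alphabet `A`: a bijection `A^n → A^n`. -/
abbrev GateFun (A : Type*) (n : ℕ) := (Fin n → A) ≃ (Fin n → A)

/-- A reversible gate over alphabet `A`: an arity together with a bijection of that arity. -/
abbrev Gate (A : Type*) := Σ n : ℕ, GateFun A n

/-- The canonical identification `A^{n+m} ≃ A^n × A^m`. -/
def splitEquiv (A : Type*) (n m : ℕ) :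
    (Fin (n + m) → A) ≃ ((Fin n → A) × (Fin m → A)) :=
  (Equiv.arrowCongr finSumFinEquiv.symm (Equiv.refl A)).trans
    (Equiv.sumArrowEquivProdArrow _ _ A)

/-- The permutation gate `P_σ`, mapping `(a_1,…,a_n)` to `(a_{σ(1)},…,a_{σ(n)})`. -/
def permGate (A : Type*) {n : ℕ} (σ : Equiv.Perm (Fin n)) : GateFun A n :=
  Equiv.arrowCongr σ.symm (Equiv.refl A)

/-- Tensor product of gates. -/
def tensorGate {A : Type*} {n m : ℕ} (F : GateFun A n) (G : GateFun A m) :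
    GateFun A (n + m) :=
  ((splitEquiv A n m).trans (F.prodCongr G)).trans (splitEquiv A n m).symm

/-- The generation relation: `Generates S g` means `g` can be generated from the set `S`
of reversible gates using the permutation, tensor product, composition and ancilla rules. -/
inductive Generates {A : Type*} (S : Set (Gate A)) : Gate A → Prop
  | mem {g : Gate A} : g ∈ S → Generates S g
  | perm (n : ℕ) (σ : Equiv.Perm (Fin n)) : Generates S ⟨n, permGate A σ⟩
  | tensor {n m : ℕ} {F : GateFun A n} {G : GateFun A m} :
      Generates S ⟨n, F⟩ → Generates S ⟨m, G⟩ → Generates S ⟨n + m, tensorGate F G⟩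
  | comp {n : ℕ} {F G : GateFun A n} :
      Generates S ⟨n, F⟩ → Generates S ⟨n, G⟩ → Generates S ⟨n, G.trans F⟩
  | ancilla {l m : ℕ} {F : GateFun A (l + m)} (a : Fin l → A) {F' : GateFun A m} :
      Generates S ⟨l + m, F⟩ →
      (∀ b : Fin m → A,
        F ((splitEquiv A l m).symm (a, b)) = (splitEquiv A l m).symm (a, F' b)) →
      Generates S ⟨m, F'⟩

/-- The gate class `⟨S⟩` generated by a set `S` of reversible gates. -/
def genClosure {A : Type*} (S : Set (Gate A)) : Set (Gate A) := {g | Generates S g}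

/-- A reversible gate class: a set of gates closed under the generation rules. -/
def IsGateClass {A : Type*} (S : Set (Gate A)) : Prop := ∀ g, Generates S g → g ∈ S

/-- The transposition gate `τ_{u,v}` exchanging the inputs `u` and `v`. -/
def tau {A : Type*} [DecidableEq A] {n : ℕ} (u v : Fin n → A) : GateFun A n :=
  Equiv.swap u v

/-- The controlled gate `w-F`, mapping `w u` to `w F(u)` and fixing all other inputs. -/
def controlled {A : Type*} [DecidableEq A] {l n : ℕ} (w : Fin l → A) (F : GateFun A n) :
    GateFun A (l + n) :=
  ((splitEquiv A l n).trans
    (Equiv.prodCongrRight fun p => if p = w then F else Equiv.refl _)).trans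
    (splitEquiv A l n).symm

/-- `SWAP_{a,b}` for single symbols `a`, `b`: exchanges `ab` and `ba`. -/
def swapGate {A : Type*} [DecidableEq A] (a b : A) : GateFun A 2 :=
  tau ![a, b] ![b, a]

/-- Number of occurrences of the symbol `a` in the string `x`. -/
def countOf {A : Type*} [DecidableEq A] {n : ℕ} (a : A) (x : Fin n → A) : ℕ :=
  (Finset.univ.filter fun i => x i = a).card

/-- If positions `i` and `j` of `x` carry the two symbols `a` and `b` (in either order),
exchange the contents of these positions. -/
def symbolSwap {A ι : Type*} [DecidableEq A] [DecidableEq ι] (a b : A) (i j : ι)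
    (x : ι → A) : ι → A :=
  if (x i = a ∧ x j = b) ∨ (x i = b ∧ x j = a) then x ∘ Equiv.swap i j else x

section

variable {A : Type*}

theorem splitEquiv_symm_eq_append {n m : ℕ} (p : Fin n → A) (q : Fin m → A) :
    (splitEquiv A n m).symm (p, q) = Fin.append p q := by
  funext t
  refine Fin.addCases (fun i => ?_) (fun i => ?_) t <;>
    simp [splitEquiv, Equiv.arrowCongr, Equiv.sumArrowEquivProdArrow]

theorem splitEquiv_append {n m : ℕ} (p : Fin n → A) (q : Fin m → A) :
    splitEquiv A n m (Fin.append p q) = (p, q) := by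
  rw [← splitEquiv_symm_eq_append, Equiv.apply_symm_apply]

theorem tensorGate_append {n m : ℕ} (F : GateFun A n) (G : GateFun A m) (p : Fin n → A)
    (q : Fin m → A) : tensorGate F G (Fin.append p q) = Fin.append (F p) (G q) := by
  simp [tensorGate, splitEquiv_append, splitEquiv_symm_eq_append]

theorem permGate_apply {n : ℕ} (σ : Equiv.Perm (Fin n)) (x : Fin n → A) :
    permGate A σ x = x ∘ σ := by
  simp [permGate, Equiv.arrowCongr]

theorem controlled_append [DecidableEq A] {l n : ℕ} (w : Fin l → A) (F : GateFun A n)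
    (p : Fin l → A) (q : Fin n → A) :
    controlled w F (Fin.append p q) = Fin.append p (if p = w then F q else q) := by
  simp only [controlled, Equiv.trans_apply, splitEquiv_append, Equiv.prodCongrRight_apply,
    splitEquiv_symm_eq_append]
  split_ifs <;> rfl

theorem generates_refl (S : Set (Gate A)) (n : ℕ) : Generates S ⟨n, Equiv.refl _⟩ :=
  Generates.perm (S := S) n (Equiv.refl _)

/-- A generated gate may be applied to any injectively chosen wires of a larger register. -/
theorem Generates.exists_embedding {S : Set (Gate A)} {m n : ℕ} {G : GateFun A m}
    (hG : Generates S ⟨m, G⟩) (e : Fin m ↪ Fin n) :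
    ∃ H : GateFun A n, Generates S ⟨n, H⟩ ∧
      ∀ x y, y ∘ e = G (x ∘ e) → (∀ i, i ∉ Set.range e → y i = x i) → H x = y := by
  obtain ⟨r, rfl⟩ : ∃ r, n = m + r :=
    ⟨n - m, by have := Fintype.card_le_of_embedding e; simp at this; omega⟩
  have := Equiv.Perm.isMultiplyPretransitive (Fin (m + r)) m
  obtain ⟨σ, hσ⟩ := MulAction.exists_smul_eq (Equiv.Perm (Fin (m + r))) (Fin.castAddEmb r) e
  have hσ' : ∀ j, σ (Fin.castAdd r j) = e j := fun j => by rw [← hσ]; rfl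
  refine ⟨_, ((Generates.perm _ σ⁻¹).comp
    ((hG.tensor (generates_refl S r)).comp (Generates.perm _ σ))), fun x y hy hxy => ?_⟩
  have hx : x ∘ σ = Fin.append (x ∘ e) (fun i => x (σ (Fin.natAdd m i))) := by
    funext t
    refine Fin.addCases (fun i => ?_) (fun i => ?_) t <;> simp [hσ']
  have hy' : y ∘ σ = Fin.append (y ∘ e) (fun i => x (σ (Fin.natAdd m i))) := by
    funext t
    refine Fin.addCases (fun i => ?_) (fun i => ?_) t
    · simp [hσ']
    · simp only [Function.comp_apply, Fin.append_right]
      refine hxy _ ?_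
      rintro ⟨j, hj⟩
      rw [← hσ', σ.injective.eq_iff] at hj
      have := congrArg Fin.val hj
      simp at this
      omega
  simp only [Equiv.trans_apply, permGate_apply]
  rw [hx, tensorGate_append, ← hy, Equiv.refl_apply, ← hy']
  funext t
  simp

/-- The ancilla rule in terms of `Fin.append`. -/
theorem Generates.of_append {S : Set (Gate A)} {l m : ℕ} {F : GateFun A (l + m)}
    {F' : GateFun A m} (hF : Generates S ⟨l + m, F⟩) (s : Fin l → A)
    (h : ∀ x, F (Fin.append s x) = Fin.append s (F' x)) : Generates S ⟨m, F'⟩ :=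
  hF.ancilla s fun x => by simpa only [splitEquiv_symm_eq_append] using h x

variable [DecidableEq A]

theorem symbolSwap_involutive {ι : Type*} [DecidableEq ι] (a b : A) (i j : ι) :
    Function.Involutive (symbolSwap a b i j) := by
  intro x
  unfold symbolSwap
  by_cases h : (x i = a ∧ x j = b) ∨ (x i = b ∧ x j = a)
  · have h' : (x j = a ∧ x i = b) ∨ (x j = b ∧ x i = a) := by tauto
    simp only [h, if_true, Function.comp_apply, Equiv.swap_apply_left,
      Equiv.swap_apply_right, h']
    funext t
    simp
  · simp [h]

theorem swapGate_apply (a b : A) (q : Fin 2 → A) :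
    swapGate a b q = symbolSwap a b 0 1 q := by
  have hq : ∀ c d, q = ![c, d] ↔ q 0 = c ∧ q 1 = d := by
    intro c d
    constructor
    · rintro rfl; simp
    · rintro ⟨rfl, rfl⟩; funext t; fin_cases t <;> rfl
  unfold swapGate tau symbolSwap
  rw [Equiv.swap_apply_def]
  simp only [hq]
  split_ifs with h1 h2 h3 h4 <;> try tauto
  all_goals
    funext t
    fin_cases t <;> simp [*]

theorem symbolSwap_apply_of_ne {ι : Type*} [DecidableEq ι] (a b : A) {i j t : ι}
    (x : ι → A) (hi : t ≠ i) (hj : t ≠ j) : symbolSwap a b i j x t = x t := by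
  unfold symbolSwap
  split_ifs <;> simp [Equiv.swap_apply_of_ne_of_ne hi hj]

theorem symbolSwap_comp {ι κ : Type*} [DecidableEq ι] [DecidableEq κ] (a b : A) {i j : ι}
    {f : ι → κ} (hf : Function.Injective f) (x : κ → A) :
    symbolSwap a b (f i) (f j) x ∘ f = symbolSwap a b i j (x ∘ f) := by
  unfold symbolSwap
  simp only [Function.comp_apply]
  split_ifs
  · funext t
    simp [hf.map_swap]
  · rfl

theorem symbolSwap_append_left {n m : ℕ} (a b : A) (i j : Fin n) (p : Fin n → A)
    (q : Fin m → A) :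
    symbolSwap a b (Fin.castAdd m i) (Fin.castAdd m j) (Fin.append p q) =
      Fin.append (symbolSwap a b i j p) q := by
  funext t
  refine Fin.addCases (fun s => ?_) (fun s => ?_) t
  · have := congrFun (symbolSwap_comp a b (i := i) (j := j) (Fin.castAdd_injective n m)
      (Fin.append p q)) s
    rw [Function.comp_apply] at this
    rw [this, Fin.append_left]
    congr 1
    funext r
    simp
  · rw [symbolSwap_apply_of_ne _ _ _ (by simp [Fin.ext_iff]; omega)
      (by simp [Fin.ext_iff]; omega)]
    simp

theorem symbolSwap_append_right {n m : ℕ} (a b : A) (i j : Fin m) (p : Fin n → A)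
    (q : Fin m → A) :
    symbolSwap a b (Fin.natAdd n i) (Fin.natAdd n j) (Fin.append p q) =
      Fin.append p (symbolSwap a b i j q) := by
  funext t
  refine Fin.addCases (fun s => ?_) (fun s => ?_) t
  · rw [symbolSwap_apply_of_ne _ _ _ (by simp [Fin.ext_iff]; omega)
      (by simp [Fin.ext_iff]; omega)]
    simp
  · have := congrFun (symbolSwap_comp a b (i := i) (j := j) (Fin.natAdd_injective m n)
      (Fin.append p q)) s
    rw [Function.comp_apply] at this
    rw [this, Fin.append_right]
    congr 1
    funext r
    simp

/-- A generated controlled swap may be applied to any distinct control and target wires. -/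
theorem exists_controlled_symbolSwap {S : Set (Gate A)} {l n : ℕ} {w : Fin l → A} {a b : A}
    (h : Generates S ⟨l + 2, controlled w (swapGate a b)⟩) {c : Fin l → Fin n}
    (hc : Function.Injective c) {i j : Fin n} (hij : i ≠ j) (hi : ∀ t, c t ≠ i)
    (hj : ∀ t, c t ≠ j) :
    ∃ H : GateFun A n, Generates S ⟨n, H⟩ ∧
      ∀ x, H x = if x ∘ c = w then symbolSwap a b i j x else x := by
  have he : Function.Injective (Fin.append c ![i, j]) := by
    rw [Fin.append_injective_iff]
    refine ⟨hc, ?_, ?_⟩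
    · intro s t
      fin_cases s <;> fin_cases t <;> simp [hij, hij.symm]
    · intro s t
      fin_cases t <;> simp [hi, hj]
  have hcomp : ∀ x : Fin n → A,
      x ∘ Fin.append c ![i, j] = Fin.append (x ∘ c) (x ∘ ![i, j]) := by
    intro x
    funext t
    refine Fin.addCases (fun s => ?_) (fun s => ?_) t <;> simp
  obtain ⟨H, hH, hHx⟩ := h.exists_embedding ⟨_, he⟩
  refine ⟨H, hH, fun x => hHx _ _ ?_ ?_⟩
  · simp only [Function.Embedding.coeFn_mk]
    rw [hcomp, hcomp, controlled_append, swapGate_apply]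
    have hinj : Function.Injective ![i, j] := by
      intro s t
      fin_cases s <;> fin_cases t <;> simp [hij, hij.symm]
    split_ifs
    · congr 1
      · funext t
        exact symbolSwap_apply_of_ne _ _ _ (hi t) (hj t)
      · exact symbolSwap_comp a b (i := 0) (j := 1) hinj x
    · rfl
  · intro t ht
    have hti : t ≠ i := fun h => ht ⟨Fin.natAdd l 0, by simp [h]⟩
    have htj : t ≠ j := fun h => ht ⟨Fin.natAdd l 1, by simp [h]⟩
    split_ifs
    · exact symbolSwap_apply_of_ne _ _ _ hti htj
    · rfl

theorem controlled_swapGate_apply {l : ℕ} (w : Fin l → A) (a b : A) (x : Fin (l + 2) → A) :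
    controlled w (swapGate a b) x =
      if x ∘ Fin.castAdd 2 = w then symbolSwap a b (Fin.natAdd l 0) (Fin.natAdd l 1) x
      else x := by
  obtain ⟨p, q, rfl⟩ : ∃ p q, x = Fin.append p q :=
    ⟨x ∘ Fin.castAdd 2, x ∘ Fin.natAdd l, (Fin.append_castAdd_natAdd (f := x)).symm⟩
  rw [controlled_append, swapGate_apply, symbolSwap_append_right]
  have : Fin.append p q ∘ Fin.castAdd 2 = p := by funext t; simp
  rw [this]
  split_ifs <;> rfl

theorem generates_swapGate_zero_controls {S : Set (Gate A)} {z : A}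
    (h : ∀ a b, Generates S ⟨1 + 2, controlled ![z] (swapGate a b)⟩) (w : Fin 0 → A) (a b : A) :
    Generates S ⟨0 + 2, controlled w (swapGate a b)⟩ := by
  obtain ⟨H, hH, hHx⟩ := exists_controlled_symbolSwap (n := 1 + (0 + 2)) (h a b)
    (c := ![Fin.castAdd _ 0]) (i := Fin.natAdd 1 (Fin.natAdd 0 0))
    (j := Fin.natAdd 1 (Fin.natAdd 0 1)) (by intro s t; simp [Subsingleton.elim s t])
    (by decide) (by decide) (by decide)
  refine hH.of_append ![z] fun x => ?_
  have hz : Fin.append ![z] x ∘ ![Fin.castAdd _ 0] = ![z] := by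
    funext t
    fin_cases t
    exact Fin.append_left _ _ _
  rw [hHx, if_pos hz, symbolSwap_append_right, controlled_swapGate_apply,
    if_pos (Subsingleton.elim _ _)]

/-- A swap controlled by an arbitrary symbol `c`: move `c` from the control wire to an ancilla
in state `z`, swap if the ancilla still holds `z`, move `c` back, and swap unconditionally. -/
theorem generates_swapGate_one_control {S : Set (Gate A)} {z : A}
    (h : ∀ a b, Generates S ⟨1 + 2, controlled ![z] (swapGate a b)⟩) (c a b : A) :
    Generates S ⟨1 + 2, controlled ![c] (swapGate a b)⟩ := by
  by_cases hcz : c = z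
  · exact hcz ▸ h a b
  obtain ⟨V, hV, hVx⟩ := exists_controlled_symbolSwap (n := 1 + (1 + 2))
    (generates_swapGate_zero_controls h ![] z c) (c := ![]) (i := Fin.castAdd _ 0)
    (j := Fin.natAdd 1 (Fin.castAdd 2 0)) (fun s => s.elim0) (by decide) (by decide) (by decide)
  obtain ⟨Q, hQ, hQx⟩ := exists_controlled_symbolSwap (n := 1 + (1 + 2))
    (generates_swapGate_zero_controls h ![] a b) (c := ![])
    (i := Fin.natAdd 1 (Fin.natAdd 1 0))
    (j := Fin.natAdd 1 (Fin.natAdd 1 1)) (fun s => s.elim0) (by decide) (by decide) (by decide)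
  obtain ⟨T, hT, hTx⟩ := exists_controlled_symbolSwap (n := 1 + (1 + 2)) (h a b)
    (c := ![Fin.castAdd _ 0]) (i := Fin.natAdd 1 (Fin.natAdd 1 0))
    (j := Fin.natAdd 1 (Fin.natAdd 1 1)) (by intro s t; simp [Subsingleton.elim s t])
    (by decide) (by decide) (by decide)
  simp only [Subsingleton.elim _ (![] : Fin 0 → A), if_true] at hVx hQx
  have hTs : ∀ (d : A) (x : Fin (1 + 2) → A), T (Fin.append ![d] x) =
      if d = z then Q (Fin.append ![d] x) else Fin.append ![d] x := by
    intro d x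
    have : Fin.append ![d] x ∘ ![Fin.castAdd _ 0] = ![z] ↔ d = z := by
      rw [funext_iff, Fin.forall_fin_one]
      rfl
    rw [hTx, hQx]
    simp only [this]
  refine (hQ.comp (hV.comp (hT.comp hV))).of_append ![z] fun x => ?_
  simp only [Equiv.trans_apply]
  rw [controlled_swapGate_apply]
  have hx : x ∘ Fin.castAdd 2 = ![c] ↔ x (Fin.castAdd 2 0) = c := by
    simp [funext_iff, Fin.forall_fin_one]
  simp only [hx]
  have hQa : ∀ (d : A) (y : Fin (1 + 2) → A), Q (Fin.append ![d] y) =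
      Fin.append ![d] (symbolSwap a b (Fin.natAdd 1 0) (Fin.natAdd 1 1) y) := by
    intro d y
    rw [hQx, symbolSwap_append_right]
  have hctl : ∀ y : Fin (1 + 2) → A,
      symbolSwap a b (Fin.natAdd 1 0) (Fin.natAdd 1 1) y (Fin.castAdd 2 0) =
        y (Fin.castAdd 2 0) := fun y => symbolSwap_apply_of_ne _ _ _ (by decide) (by decide)
  by_cases hxc : x (Fin.castAdd 2 0) = c
  · have hmove : V (Fin.append ![z] x) =
        Fin.append ![c] (Function.update x (Fin.castAdd 2 0) z) := by
      rw [hVx, symbolSwap, if_pos (Or.inl ⟨rfl, hxc⟩)]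
      funext t
      fin_cases t
      · exact hxc
      all_goals rfl
    have hback : V (V (Fin.append ![z] x)) = Fin.append ![z] x := by
      rw [hVx, hVx, symbolSwap_involutive]
    rw [if_pos hxc, ← hQa, hmove, hTs, if_neg hcz, ← hmove, hback]
  · have hstay : ∀ y : Fin (1 + 2) → A, y (Fin.castAdd 2 0) ≠ c →
        V (Fin.append ![z] y) = Fin.append ![z] y := by
      intro y hy
      rw [hVx, symbolSwap, if_neg]
      rintro (⟨-, h⟩ | ⟨h, -⟩)
      exacts [hy h, hcz h.symm]
    rw [if_neg hxc, hstay x hxc, hTs, if_pos rfl, hQa, hstay _ (by rwa [hctl]), hQa,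
      symbolSwap_involutive]

/-- Adding one control: a commutator on the ancilla state `![p, q, r]` turns its first symbol
into `q` exactly when both control conditions hold. -/
theorem generates_swapGate_succ_controls {S : Set (Gate A)} {p q r : A} (hpq : p ≠ q)
    (hpr : p ≠ r) (hqr : q ≠ r)
    (h₁ : ∀ c a b, Generates S ⟨1 + 2, controlled ![c] (swapGate a b)⟩) {l : ℕ}
    (hl : ∀ (w : Fin l → A) a b, Generates S ⟨l + 2, controlled w (swapGate a b)⟩)
    (w : Fin (l + 1) → A) (a b : A) :
    Generates S ⟨l + 1 + 2, controlled w (swapGate a b)⟩ := by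
  obtain ⟨G, hG, hGx⟩ := exists_controlled_symbolSwap (n := 3 + (l + 1 + 2))
    (hl (w ∘ Fin.castSucc) p q)
    (c := fun t => Fin.natAdd 3 (Fin.castAdd 2 t.castSucc)) (i := Fin.castAdd _ 0)
    (j := Fin.castAdd _ 1) (by intro s t; simp [Fin.ext_iff])
    (by simp [Fin.ext_iff]) (by simp [Fin.ext_iff]) (by simp [Fin.ext_iff]; omega)
  obtain ⟨H, hH, hHx⟩ := exists_controlled_symbolSwap (n := 3 + (l + 1 + 2))
    (h₁ (w (Fin.last l)) q r)
    (c := ![Fin.natAdd 3 (Fin.castAdd 2 (Fin.last l))]) (i := Fin.castAdd _ 0)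
    (j := Fin.castAdd _ 2) (by intro s t; simp [Subsingleton.elim s t])
    (by simp [Fin.ext_iff]) (by simp [Fin.ext_iff]) (by simp [Fin.ext_iff]; omega)
  obtain ⟨T, hT, hTx⟩ := exists_controlled_symbolSwap (n := 3 + (l + 1 + 2)) (h₁ q a b)
    (c := ![Fin.castAdd _ 0]) (i := Fin.natAdd 3 (Fin.natAdd (l + 1) 0))
    (j := Fin.natAdd 3 (Fin.natAdd (l + 1) 1)) (by intro s t; simp [Subsingleton.elim s t])
    (by simp [Fin.ext_iff]) (by simp [Fin.ext_iff]) (by simp [Fin.ext_iff])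
  have hGs : ∀ s x, G (Fin.append s x) =
      if ∀ t : Fin l, x (Fin.castAdd 2 t.castSucc) = w t.castSucc then
        Fin.append (symbolSwap p q 0 1 s) x else Fin.append s x := by
    intro s x
    rw [hGx, symbolSwap_append_left]
    simp [funext_iff]
  have hHs : ∀ s x, H (Fin.append s x) =
      if x (Fin.castAdd 2 (Fin.last l)) = w (Fin.last l) then
        Fin.append (symbolSwap q r 0 2 s) x else Fin.append s x := by
    intro s x
    rw [hHx, symbolSwap_append_left]
    simp [funext_iff]
  have hTs : ∀ s x, T (Fin.append s x) =
      if s 0 = q then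
        Fin.append s (symbolSwap a b (Fin.natAdd (l + 1) 0) (Fin.natAdd (l + 1) 1) x)
      else Fin.append s x := by
    intro s x
    rw [hTx, symbolSwap_append_right]
    simp [funext_iff]
  have hU := hH.comp (hG.comp (hH.comp hG))
  have hU' := hG.comp (hH.comp (hG.comp hH))
  refine (hU'.comp (hT.comp hU)).of_append ![p, q, r] fun x => ?_
  have hg : symbolSwap p q 0 1 ![p, q, r] = ![q, p, r] := by
    funext t
    fin_cases t <;> simp [symbolSwap, Equiv.swap_apply_def]
  have hg' : symbolSwap p q 0 1 ![q, p, r] = ![p, q, r] := by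
    rw [← hg, symbolSwap_involutive]
  have hg'' : symbolSwap p q 0 1 ![r, p, q] = ![r, p, q] := by
    simp [symbolSwap, hpr.symm, hqr.symm]
  have hh : symbolSwap q r 0 2 ![p, q, r] = ![p, q, r] := by
    simp [symbolSwap, hpq, hpr]
  have hh' : symbolSwap q r 0 2 ![q, p, r] = ![r, p, q] := by
    funext t
    fin_cases t <;> simp [symbolSwap, Equiv.swap_apply_def]
  have hh'' : symbolSwap q r 0 2 ![r, p, q] = ![q, p, r] := by
    rw [← hh', symbolSwap_involutive]
  have hctl : ∀ t, symbolSwap a b (Fin.natAdd (l + 1) 0) (Fin.natAdd (l + 1) 1) x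
      (Fin.castAdd 2 t) = x (Fin.castAdd 2 t) := fun t =>
    symbolSwap_apply_of_ne _ _ _ (by simp [Fin.ext_iff]; omega) (by simp [Fin.ext_iff]; omega)
  have hw : x ∘ Fin.castAdd 2 = w ↔
      (∀ t : Fin l, x (Fin.castAdd 2 t.castSucc) = w t.castSucc) ∧
        x (Fin.castAdd 2 (Fin.last l)) = w (Fin.last l) := by
    simp [funext_iff, Fin.forall_fin_succ']
  rw [controlled_swapGate_apply]
  simp only [hw]
  by_cases hx₁ : ∀ t : Fin l, x (Fin.castAdd 2 t.castSucc) = w t.castSucc <;>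
    by_cases hx₂ : x (Fin.castAdd 2 (Fin.last l)) = w (Fin.last l) <;>
    simp [hGs, hHs, hTs, hx₁, hx₂, hctl, hg, hg', hg'', hh, hh', hh'', hpq]

end

/-- Over `A = {1,…,k}` with `k ≥ 3`, the set `S` of gates `1-SWAP_{a,b}` for all
`a ≠ b ∈ A` generates the controlled swap `w-SWAP_{a,b}` for every string `w` over
`A` and all `a, b ∈ A`. -/
theorem generates_controlled_swap (k : ℕ) (hk : 3 ≤ k)
    (l : ℕ) (w : Fin l → Fin k) (a b : Fin k) :
    Generates {g : Gate (Fin k) | ∃ a b : Fin k, a ≠ b ∧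
      g = ⟨1 + 2, controlled ![(⟨0, by omega⟩ : Fin k)] (swapGate a b)⟩}
      ⟨l + 2, controlled w (swapGate a b)⟩ := by
  set z : Fin k := ⟨0, by omega⟩
  have h : ∀ a b, Generates {g : Gate (Fin k) | ∃ a b : Fin k, a ≠ b ∧
      g = ⟨1 + 2, controlled ![z] (swapGate a b)⟩}
      ⟨1 + 2, controlled ![z] (swapGate a b)⟩ := by
    intro a b
    by_cases hab : a = b
    · have : controlled ![z] (swapGate a b) = Equiv.refl _ := by
        ext x : 1
        rw [controlled_swapGate_apply]
        split_ifs
        · subst hab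
          funext t
          unfold symbolSwap
          split_ifs with hx
          · rw [Function.comp_apply, Equiv.swap_apply_def]
            split_ifs <;> simp_all
          · rfl
        · rfl
      exact this ▸ generates_refl _ _
    · exact Generates.mem ⟨a, b, hab, rfl⟩
  induction l generalizing a b with
  | zero => exact generates_swapGate_zero_controls h w a b
  | succ l ih =>
    exact generates_swapGate_succ_controls (p := ⟨0, by omega⟩) (q := ⟨1, by omega⟩)
      (r := ⟨2, by omega⟩) (by simp [Fin.ext_iff]) (by simp [Fin.ext_iff])
      (by simp [Fin.ext_iff]) (generates_swapGate_one_control h)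
      ih w a b
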